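/- arXiv:2502.19079 — 2 statements merged into one kernel-verified Lean document; each statement's English description precedes it below -/
import Mathlib

section
/- Let {a_n} be a non-decreasing sequence of positive integers with a_n ≥ n^{1+ε} for some ε > 0 and all large n, and with limsup_{n→∞} a_n^{1/(M+2)^n} = ∞ for a fixed real M ≥ 0. Let {b_n} be positive integers with b_n ≤ 2^{(log₂ a_n)^κ} for some fixed 0 < κ < 1 and all large n. Then for any fixed 0 < c < 1, liminf_{N→∞} 2^{N²(log₂ a_{N−1})^c} · ( ∏_{n=1}^{N−1} a_n )^{M+1} · Σ_{n=N}^∞ b_n/a_n = 0. -/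
open Filter Real

theorem eventually_mul_rpow_le_mul_rpow {p τ : ℝ} (hp : p < τ) (K : ℝ) {η : ℝ} (hη : 0 < η) :
    ∀ᶠ x : ℝ in atTop, K * x ^ p ≤ η * x ^ τ := by
  have h := (tendsto_rpow_neg_atTop (sub_pos.mpr hp)).const_mul K
  rw [mul_zero] at h
  filter_upwards [h.eventually (gt_mem_nhds hη), eventually_gt_atTop 0] with x hx hx0
  calc K * x ^ p = K * x ^ (-(τ - p)) * x ^ τ := by
        rw [mul_assoc, ← Real.rpow_add hx0]; ring_nf
    _ ≤ η * x ^ τ := by gcongr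

theorem eventually_quadratic_mul_two_rpow_lt {p τ : ℝ} (hτ : 0 < τ) (hp : p < τ)
    (K₁ K₂ K η δ₀ : ℝ) (hη : 0 < η) (hδ₀ : 0 < δ₀) :
    ∀ᶠ x : ℝ in atTop, (K₁ * x ^ 2 + K₂) * (2 : ℝ) ^ (K * x ^ p - η * x ^ τ) < δ₀ := by
  have hlog : 0 < Real.log 2 := Real.log_pos one_lt_two
  have hτ' : Tendsto (fun x : ℝ => x ^ τ) atTop atTop := tendsto_rpow_atTop hτ
  have hb : 0 < Real.log 2 * (η / 2) := by positivity
  have h2 := (tendsto_rpow_mul_exp_neg_mul_atTop_nhds_zero (2 / τ) _ hb).comp hτ'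
  have h0 := (tendsto_rpow_mul_exp_neg_mul_atTop_nhds_zero 0 _ hb).comp hτ'
  have hsum := (h2.const_mul |K₁|).add (h0.const_mul |K₂|)
  simp only [mul_zero, add_zero] at hsum
  filter_upwards [hsum.eventually (gt_mem_nhds hδ₀),
    eventually_mul_rpow_le_mul_rpow hp K (half_pos hη), eventually_gt_atTop 0]
    with x hx hbd hx0
  refine lt_of_le_of_lt ?_ hx
  have hxτ : 0 < x ^ τ := rpow_pos_of_pos hx0 _
  have hexp : (2 : ℝ) ^ (K * x ^ p - η * x ^ τ) ≤ Real.exp (-(Real.log 2 * (η / 2)) * x ^ τ) := by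
    rw [Real.rpow_def_of_pos two_pos]
    apply Real.exp_le_exp.mpr
    nlinarith
  have hsq : (x ^ τ) ^ (2 / τ) = x ^ 2 := by
    rw [← Real.rpow_mul hx0.le, mul_div_cancel₀ _ hτ.ne']
    exact Real.rpow_two x
  simp only [Function.comp_apply, hsq, Real.rpow_zero, one_mul]
  calc (K₁ * x ^ 2 + K₂) * (2 : ℝ) ^ (K * x ^ p - η * x ^ τ)
      ≤ (|K₁| * x ^ 2 + |K₂|) * (2 : ℝ) ^ (K * x ^ p - η * x ^ τ) := by
        gcongr <;> exact le_abs_self _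
    _ ≤ (|K₁| * x ^ 2 + |K₂|) * Real.exp (-(Real.log 2 * (η / 2)) * x ^ τ) := by gcongr
    _ = _ := by ring

theorem exists_antitoneOn_sq_mul_two_rpow {κ : ℝ} (hκ0 : 0 < κ) (hκ1 : κ < 1) :
    ∃ x₀ : ℝ, 1 ≤ x₀ ∧
      AntitoneOn (fun x : ℝ => x ^ 2 * (2 : ℝ) ^ (x ^ κ - x)) (Set.Ici x₀) := by
  have hlog : 0 < Real.log 2 := Real.log_pos one_lt_two
  have h1 : ∀ᶠ x : ℝ in atTop, x ^ (-(1 - κ)) < 1 / 2 :=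
    (tendsto_rpow_neg_atTop (sub_pos.mpr hκ1)).eventually (gt_mem_nhds (by norm_num))
  obtain ⟨x₁, hx₁⟩ := eventually_atTop.mp h1
  refine ⟨max (max 1 x₁) (4 / Real.log 2), (le_max_left _ _).trans (le_max_left _ _), ?_⟩
  intro x hx y _ hxy
  simp only [Set.mem_Ici, max_le_iff] at hx
  obtain ⟨⟨hx1, hxx₁⟩, hx4⟩ := hx
  have hx0 : 0 < x := by linarith
  have hy0 : 0 < y := by linarith
  have hpow : y ^ κ - x ^ κ ≤ (y - x) / 2 := by
    have hyx : 1 ≤ y / x := (one_le_div hx0).mpr hxy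
    have e1 : y ^ κ = x ^ κ * (y / x) ^ κ := by
      rw [← Real.mul_rpow hx0.le (by positivity), mul_div_cancel₀ _ hx0.ne']
    have e2 : (y / x) ^ κ ≤ y / x := Real.rpow_le_self_of_one_le hyx hκ1.le
    have e3 : x ^ κ = x ^ (-(1 - κ)) * x := by
      rw [← Real.rpow_add_one hx0.ne']; ring_nf
    have e4 := hx₁ x hxx₁
    calc y ^ κ - x ^ κ ≤ x ^ κ * (y / x) - x ^ κ := by
          rw [e1]; gcongr
      _ = x ^ (-(1 - κ)) * (y - x) := by rw [e3]; field_simp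
      _ ≤ 1 / 2 * (y - x) := by
          apply mul_le_mul_of_nonneg_right e4.le; linarith
      _ = _ := by ring
  have hratio : y ^ 2 ≤ x ^ 2 * (2 : ℝ) ^ ((y - x) / 2) := by
    have e1 : y ≤ x * (2 : ℝ) ^ ((y - x) / 4) := by
      have : (y - x) / x ≤ Real.log 2 * ((y - x) / 4) := by
        rw [div_le_iff₀ hx0]
        rw [div_le_iff₀ hlog] at hx4
        nlinarith
      calc y = x * ((y - x) / x + 1) := by field_simp; ring
        _ ≤ x * Real.exp ((y - x) / x) := by gcongr; exact Real.add_one_le_exp _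
        _ ≤ x * Real.exp (Real.log 2 * ((y - x) / 4)) := by gcongr
        _ = _ := by rw [Real.rpow_def_of_pos two_pos]
    calc y ^ 2 ≤ (x * (2 : ℝ) ^ ((y - x) / 4)) ^ 2 := by gcongr
      _ = x ^ 2 * ((2 : ℝ) ^ ((y - x) / 4) * (2 : ℝ) ^ ((y - x) / 4)) := by ring
      _ = _ := by rw [← Real.rpow_add two_pos]; ring_nf
  calc y ^ 2 * (2 : ℝ) ^ (y ^ κ - y)
      ≤ x ^ 2 * (2 : ℝ) ^ ((y - x) / 2) * (2 : ℝ) ^ (y ^ κ - y) := by gcongr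
    _ = x ^ 2 * (2 : ℝ) ^ ((y - x) / 2 + (y ^ κ - y)) := by
        rw [Real.rpow_add two_pos]; ring
    _ ≤ x ^ 2 * (2 : ℝ) ^ (x ^ κ - x) := by
        gcongr
        · exact one_le_two
        · linarith

theorem exists_tsum_tail_le {A u : ℕ → ℝ} (hA : Monotone A) (hu : ∀ n, 0 ≤ u n)
    {ε κ : ℝ} (hε : 0 < ε) (hκ1 : κ < 1)
    (hgrow : ∀ᶠ n : ℕ in atTop, (n : ℝ) ^ (1 + ε) ≤ (2 : ℝ) ^ A n)
    (hAtop : Tendsto A atTop atTop)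
    (hbd : ∀ᶠ n in atTop, u n ≤ (2 : ℝ) ^ (A n ^ κ - A n)) :
    Summable u ∧ ∃ C δ : ℝ, 0 < C ∧ 0 < δ ∧ ∀ᶠ L : ℕ in atTop,
      ∑' n, u (L + n) ≤ C * (2 : ℝ) ^ (-(δ * A L)) := by
  set δ : ℝ := ε / (4 * (1 + ε)) with hδ
  have hδ0 : 0 < δ := by positivity
  have hδ1 : (1 + ε) * (1 - 2 * δ) = 1 + ε / 2 := by rw [hδ]; field_simp; ring
  have hδ2 : 0 < 1 - 2 * δ := by
    by_contra! h
    nlinarith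
  have hsmall : ∀ᶠ n in atTop, A n ^ κ ≤ δ * A n := by
    filter_upwards [hAtop.eventually (eventually_mul_rpow_le_mul_rpow hκ1 1 hδ0)] with n hn
    simpa using hn
  have hsum : Summable (fun n : ℕ => (n : ℝ) ^ (-(1 + ε / 2))) :=
    Real.summable_nat_rpow.mpr (by linarith)
  have hkey : ∀ᶠ n : ℕ in atTop, u n ≤ (n : ℝ) ^ (-(1 + ε / 2)) * (2 : ℝ) ^ (-(δ * A n)) := by
    filter_upwards [hgrow, hbd, hsmall, eventually_gt_atTop 0] with n h1 h2 h3 h4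
    have hn : (0 : ℝ) < n := by exact_mod_cast h4
    calc u n ≤ (2 : ℝ) ^ (A n ^ κ - A n) := h2
      _ ≤ (2 : ℝ) ^ (A n * (-(1 - 2 * δ)) + -(δ * A n)) := by
          apply Real.rpow_le_rpow_of_exponent_le one_le_two; linarith
      _ = ((2 : ℝ) ^ A n) ^ (-(1 - 2 * δ)) * (2 : ℝ) ^ (-(δ * A n)) := by
          rw [Real.rpow_add two_pos, Real.rpow_mul two_pos.le]
      _ ≤ ((n : ℝ) ^ (1 + ε)) ^ (-(1 - 2 * δ)) * (2 : ℝ) ^ (-(δ * A n)) := by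
          gcongr ?_ * _
          exact Real.rpow_le_rpow_of_nonpos (by positivity) h1 (by linarith)
      _ = _ := by rw [← Real.rpow_mul hn.le, mul_neg, hδ1]
  obtain ⟨n₀, hn₀⟩ := eventually_atTop.mp (hkey.and (hAtop.eventually_ge_atTop 0))
  have hus : Summable u := by
    rw [← summable_nat_add_iff n₀]
    refine Summable.of_nonneg_of_le (fun n => hu _) (fun n => ?_)
      ((summable_nat_add_iff n₀).mpr hsum)
    obtain ⟨h1, h2⟩ := hn₀ (n + n₀) (by omega)
    refine h1.trans (mul_le_of_le_one_right (by positivity) ?_)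
    exact Real.rpow_le_one_of_one_le_of_nonpos one_le_two (by nlinarith)
  refine ⟨hus, (∑' n : ℕ, (n : ℝ) ^ (-(1 + ε / 2))) + 1, δ, ?_, hδ0, ?_⟩
  · have : 0 ≤ ∑' n : ℕ, (n : ℝ) ^ (-(1 + ε / 2)) := tsum_nonneg fun n => by positivity
    linarith
  · filter_upwards [eventually_ge_atTop n₀] with L hL
    have hinj : Function.Injective (fun n : ℕ => L + n) := add_right_injective L
    have hs1 : Summable fun n => u (L + n) := hus.comp_injective hinj
    have hs2 : Summable fun n : ℕ => ((L + n : ℕ) : ℝ) ^ (-(1 + ε / 2)) :=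
      hsum.comp_injective hinj
    calc ∑' n, u (L + n)
        ≤ ∑' n : ℕ, ((L + n : ℕ) : ℝ) ^ (-(1 + ε / 2)) * (2 : ℝ) ^ (-(δ * A L)) := by
          refine hs1.tsum_le_tsum (fun n => ?_) (hs2.mul_right _)
          refine (hn₀ (L + n) (by omega)).1.trans ?_
          have := hA (Nat.le_add_right L n)
          gcongr
          exact one_le_two
      _ = (∑' n : ℕ, ((L + n : ℕ) : ℝ) ^ (-(1 + ε / 2))) * (2 : ℝ) ^ (-(δ * A L)) := tsum_mul_right
      _ ≤ _ := by
          gcongr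
          have := hs2.tsum_le_tsum_of_inj (fun n => L + n) hinj (fun _ _ => by positivity)
            (fun n => le_rfl) hsum
          linarith

theorem eventually_sq_le_rpow {T θ σ : ℝ} (hT : 2 ≤ T) (hθ : 0 < θ) (hσ : 0 < σ) :
    ∀ᶠ N : ℕ in atTop, (N : ℝ) ^ 2 ≤ (θ * T ^ N) ^ σ := by
  obtain ⟨k, hk⟩ := exists_nat_ge (2 / σ)
  have h := tendsto_pow_const_div_const_pow_of_one_lt k (by linarith : 1 < T)
  filter_upwards [h.eventually (gt_mem_nhds hθ), eventually_ge_atTop 1] with N hN hN1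
  have hN1' : (1 : ℝ) ≤ N := by exact_mod_cast hN1
  have hTN : 0 < T ^ N := by positivity
  rw [div_lt_iff₀ hTN] at hN
  have hkσ : 2 ≤ k * σ := by rwa [div_le_iff₀ hσ] at hk
  calc (N : ℝ) ^ 2 = (N : ℝ) ^ (2 : ℝ) := (Real.rpow_two _).symm
    _ ≤ (N : ℝ) ^ (k * σ) := Real.rpow_le_rpow_of_exponent_le hN1' hkσ
    _ = ((N : ℝ) ^ k) ^ σ := by rw [Real.rpow_mul (by positivity), Real.rpow_natCast]
    _ ≤ _ := by gcongr

theorem mul_sum_range_le_of_le_mul_pow {A : ℕ → ℝ} {T B : ℝ} (hT : 1 ≤ T) (hB : 0 ≤ B) {m N : ℕ}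
    (hmN : m ≤ N) (h : ∀ n, m ≤ n → n < N → A n ≤ B * T ^ n) :
    (T - 1) * ∑ n ∈ Finset.range N, A n ≤ (T - 1) * ∑ n ∈ Finset.range m, A n + B * T ^ N := by
  induction N, hmN using Nat.le_induction with
  | base => have : 0 ≤ B * T ^ m := by positivity
            linarith
  | succ N hmN ih =>
    have h1 := ih fun n hn hnN => h n hn (by omega)
    have h2 := mul_le_mul_of_nonneg_left (h N hmN (by omega)) (sub_nonneg.mpr hT)
    rw [Finset.sum_range_succ, pow_succ]
    nlinarith

/-- An increasing comparison factor with values in `[1, 2)` whose relative increments are at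
least of order `1 / n ^ 2`. -/
noncomputable def recordFactor (n : ℕ) : ℝ := 2 - 1 / ((n : ℝ) + 1)

theorem one_le_recordFactor (n : ℕ) : 1 ≤ recordFactor n := by
  have h : 1 / ((n : ℝ) + 1) ≤ 1 := by
    rw [div_le_one (by positivity)]
    have : (0 : ℝ) ≤ n := n.cast_nonneg
    linarith
  unfold recordFactor
  linarith

theorem recordFactor_le_two (n : ℕ) : recordFactor n ≤ 2 := by
  have : 0 ≤ 1 / ((n : ℝ) + 1) := by positivity
  unfold recordFactor
  linarith

theorem recordFactor_le_of_lt {n N : ℕ} (h : n < N) :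
    recordFactor n ≤ (1 - 1 / (4 * (N : ℝ) ^ 2)) * recordFactor N := by
  have hN1 : (1 : ℝ) ≤ N := by exact_mod_cast (by omega : 1 ≤ N)
  have hN0 : (0 : ℝ) < N := by linarith
  have hnN : (n : ℝ) + 1 ≤ N := by exact_mod_cast h
  have h1 : 1 / (N : ℝ) ≤ 1 / ((n : ℝ) + 1) := one_div_le_one_div_of_le (by positivity) hnN
  have h2 : 1 / (4 * (N : ℝ) ^ 2) * recordFactor N ≤ 1 / (4 * (N : ℝ) ^ 2) * 2 := by
    gcongr
    exact recordFactor_le_two N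
  have h3 : 1 / (4 * (N : ℝ) ^ 2) * 2 ≤ 1 / (N : ℝ) - 1 / ((N : ℝ) + 1) := by
    have : 1 / (N : ℝ) - 1 / ((N : ℝ) + 1) = 1 / (N * (N + 1)) := by field_simp; ring
    rw [this, one_div_mul_eq_div, div_le_div_iff₀ (by positivity) (by positivity)]
    nlinarith
  have h4 : recordFactor n ≤ 2 - 1 / (N : ℝ) := by unfold recordFactor; linarith
  have h5 : recordFactor N = 2 - 1 / ((N : ℝ) + 1) := rfl
  linarith

theorem sum_Ico_le_of_le_two_rpow {A u : ℕ → ℝ} (hA : Monotone A) {κ x₀ : ℝ} {N L : ℕ}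
    (hx₀ : AntitoneOn (fun x : ℝ => x ^ 2 * (2 : ℝ) ^ (x ^ κ - x)) (Set.Ici x₀))
    (hN : 1 ≤ N) (hAN : x₀ ≤ A N) (hAn : ∀ n, N ≤ n → n < L → (n : ℝ) ≤ A n)
    (hu : ∀ n, N ≤ n → u n ≤ (2 : ℝ) ^ (A n ^ κ - A n)) :
    ∑ n ∈ Finset.Ico N L, u n
      ≤ (∑' n : ℕ, 1 / (n : ℝ) ^ 2) * (A N ^ 2 * (2 : ℝ) ^ (A N ^ κ - A N)) := by
  have hs : Summable fun n : ℕ => 1 / (n : ℝ) ^ 2 :=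
    Real.summable_one_div_nat_pow.mpr one_lt_two
  calc ∑ n ∈ Finset.Ico N L, u n
      ≤ ∑ n ∈ Finset.Ico N L, 1 / (n : ℝ) ^ 2 * (A N ^ 2 * (2 : ℝ) ^ (A N ^ κ - A N)) := by
        refine Finset.sum_le_sum fun n hn => ?_
        obtain ⟨hn1, hn2⟩ := Finset.mem_Ico.mp hn
        have hn0 : (0 : ℝ) < n := by exact_mod_cast (by omega : 0 < n)
        have hanti := hx₀ (Set.mem_Ici.mpr hAN) (Set.mem_Ici.mpr (hAN.trans (hA hn1))) (hA hn1)
        refine (hu n hn1).trans ?_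
        rw [one_div_mul_eq_div, le_div_iff₀ (by positivity), mul_comm]
        refine le_trans ?_ hanti
        have := hAn n hn1 hn2
        dsimp only
        gcongr
    _ = (∑ n ∈ Finset.Ico N L, 1 / (n : ℝ) ^ 2) * (A N ^ 2 * (2 : ℝ) ^ (A N ^ κ - A N)) := by
        rw [Finset.sum_mul]
    _ ≤ _ := by
        gcongr
        exact hs.sum_le_tsum _ fun _ _ => by positivity

theorem eventually_two_rpow_mul_tsum_lt_of_jump {A u : ℕ → ℝ} {c T C δ θ : ℝ}
    (hu : ∀ n, 0 ≤ u n) (hc1 : c < 1) (hT : 2 ≤ T) (hδ : 0 < δ) (hθ0 : 0 < θ)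
    (hAtop : Tendsto A atTop atTop)
    (htail : ∀ᶠ L : ℕ in atTop, ∑' n, u (L + n) ≤ C * (2 : ℝ) ^ (-(δ * A L)))
    {δ₀ : ℝ} (hδ₀ : 0 < δ₀) :
    ∀ᶠ N : ℕ in atTop, θ * T ^ N ≤ A N →
      2 * (T - 1) / δ * ∑ n ∈ Finset.range N, A n ≤ A N →
      (2 : ℝ) ^ ((N : ℝ) ^ 2 * A N ^ c + (T - 1) * ∑ n ∈ Finset.range N, A n)
        * ∑' n, u (N + n) < δ₀ := by
  set σ : ℝ := (1 - c) / 2 with hσ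
  have hσ0 : 0 < σ := by rw [hσ]; linarith
  have hq := hAtop.eventually (eventually_quadratic_mul_two_rpow_lt one_pos
    (by rw [hσ]; linarith : c + σ < 1) 0 C 1 (δ / 2) δ₀ (by positivity) hδ₀)
  filter_upwards [hq, htail, hAtop.eventually_ge_atTop 1, eventually_sq_le_rpow hT hθ0 hσ0]
    with N hq htl hx1 hsq h1 h2
  have hx0 : 0 < A N := by linarith
  have hsq' : (N : ℝ) ^ 2 ≤ A N ^ σ := hsq.trans (by gcongr)
  refine lt_of_le_of_lt ?_ hq
  have hNc : (N : ℝ) ^ 2 * A N ^ c ≤ A N ^ (c + σ) := by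
    calc (N : ℝ) ^ 2 * A N ^ c ≤ A N ^ σ * A N ^ c := by gcongr
      _ = _ := by rw [← Real.rpow_add hx0, add_comm]
  have hS : (T - 1) * ∑ n ∈ Finset.range N, A n ≤ δ / 2 * A N := by
    calc _ = δ / 2 * (2 * (T - 1) / δ * ∑ n ∈ Finset.range N, A n) := by field_simp
      _ ≤ _ := by gcongr
  calc _ ≤ (2 : ℝ) ^ (A N ^ (c + σ) + δ / 2 * A N) * (C * (2 : ℝ) ^ (-(δ * A N))) := by
        gcongr
        · exact tsum_nonneg fun _ => hu _
        · exact one_le_two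
    _ = C * (2 : ℝ) ^ (A N ^ (c + σ) + δ / 2 * A N + -(δ * A N)) := by
        rw [Real.rpow_add two_pos _ (-(δ * A N))]; ring
    _ = _ := by rw [zero_mul, zero_add, Real.rpow_one]; ring_nf

theorem eventually_two_rpow_mul_tsum_lt_of_record {A u : ℕ → ℝ} {κ c T C δ θ : ℝ}
    (hA : Monotone A) (hus : Summable u)
    (hκ0 : 0 < κ) (hκ1 : κ < 1) (hc1 : c < 1) (hT : 2 ≤ T) (hC : 0 < C) (hθ0 : 0 < θ)
    (hAtop : Tendsto A atTop atTop)
    (hbd : ∀ᶠ n in atTop, u n ≤ (2 : ℝ) ^ (A n ^ κ - A n))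
    (htail : ∀ᶠ L : ℕ in atTop, ∑' n, u (L + n) ≤ C * (2 : ℝ) ^ (-(δ * A L)))
    {δ₀ : ℝ} (hδ₀ : 0 < δ₀) :
    ∀ᶠ N : ℕ in atTop, ∀ (m L : ℕ) (Θ : ℝ), m ≤ N → N ≤ L → θ ≤ Θ →
      (∑ n ∈ Finset.range m, A n ≤ (m : ℝ) ^ 2) →
      (∀ n, m ≤ n → n < N → A n < Θ * recordFactor n * T ^ n) →
      Θ * recordFactor N * T ^ N ≤ A N →
      (∀ n, N ≤ n → n < L → (n : ℝ) ≤ A n) → A N ≤ δ * A L →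
      (2 : ℝ) ^ ((N : ℝ) ^ 2 * A N ^ c + (T - 1) * ∑ n ∈ Finset.range N, A n)
        * ∑' n, u (N + n) < δ₀ := by
  set s : ℝ := max c κ
  have hs1 : s < 1 := max_lt hc1 hκ1
  have hcs : c ≤ s := le_max_left _ _
  have hκs : κ ≤ s := le_max_right _ _
  set σ : ℝ := (1 - s) / 4 with hσ
  have hσ0 : 0 < σ := by rw [hσ]; linarith
  set Z : ℝ := ∑' n : ℕ, 1 / (n : ℝ) ^ 2 with hZ
  have hZ0 : 0 ≤ Z := tsum_nonneg fun n => by positivity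
  obtain ⟨N₁, hN₁⟩ := eventually_atTop.mp (htail.and hbd)
  obtain ⟨x₀, hx₀1, hx₀⟩ := exists_antitoneOn_sq_mul_two_rpow hκ0 hκ1
  have hq := hAtop.eventually (eventually_quadratic_mul_two_rpow_lt
    (by linarith : 0 < 1 - σ) (by linarith : s + σ < 1 - σ) Z C (T + 1) (1 / 4) δ₀
    (by positivity) hδ₀)
  filter_upwards [hq, eventually_ge_atTop N₁, hAtop.eventually_ge_atTop x₀,
    eventually_sq_le_rpow hT hθ0 hσ0, eventually_ge_atTop 1]
    with N hq hNN₁ hxx₀ hsq hN1 m L Θ hmN hNL hθΘ hm hlt hge hlow hL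
  have hx1 : 1 ≤ A N := hx₀1.trans hxx₀
  have hx0 : 0 < A N := by linarith
  have hTN : 0 < T ^ N := by positivity
  have hΘ0 : 0 < Θ := by linarith
  have hNR : (1 : ℝ) ≤ N := by exact_mod_cast hN1
  have hθA : θ * T ^ N ≤ A N := by
    refine le_trans ?_ hge
    gcongr
    nlinarith [one_le_recordFactor N]
  have hsq' : (N : ℝ) ^ 2 ≤ A N ^ σ := hsq.trans (by gcongr)
  have hNc : (N : ℝ) ^ 2 * A N ^ c ≤ A N ^ (s + σ) := by
    calc (N : ℝ) ^ 2 * A N ^ c ≤ A N ^ σ * A N ^ s := by gcongr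
      _ = _ := by rw [← Real.rpow_add hx0, add_comm]
  have hσp : A N ^ σ ≤ A N ^ (s + σ) := by
    gcongr
    linarith
  have hκp : A N ^ κ ≤ A N ^ (s + σ) := by
    gcongr
    linarith
  have hgain : A N ^ (1 - σ) ≤ 1 / (N : ℝ) ^ 2 * A N := by
    rw [one_div_mul_eq_div, le_div_iff₀ (by positivity)]
    calc A N ^ (1 - σ) * (N : ℝ) ^ 2 ≤ A N ^ (1 - σ) * A N ^ σ := by gcongr
      _ = A N := by rw [← Real.rpow_add hx0]; simp
  have hcoef : 0 ≤ 1 - 1 / (4 * (N : ℝ) ^ 2) := by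
    rw [sub_nonneg, div_le_one (by positivity)]
    nlinarith
  have hsum : (T - 1) * ∑ n ∈ Finset.range N, A n
      ≤ (T - 1) * (N : ℝ) ^ 2 + (1 - 1 / (4 * (N : ℝ) ^ 2)) * A N := by
    have h1 := mul_sum_range_le_of_le_mul_pow (A := A) (T := T)
      (B := Θ * ((1 - 1 / (4 * (N : ℝ) ^ 2)) * recordFactor N)) (by linarith)
      (mul_nonneg hΘ0.le (mul_nonneg hcoef (by linarith [one_le_recordFactor N]))) hmN
      (fun n hn hnN => (hlt n hn hnN).le.trans (by
        gcongr
        exact recordFactor_le_of_lt hnN))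
    refine h1.trans (add_le_add ?_ ?_)
    · have hmN' : (m : ℝ) ≤ N := by exact_mod_cast hmN
      have : ∑ n ∈ Finset.range m, A n ≤ (N : ℝ) ^ 2 := hm.trans (by gcongr)
      exact mul_le_mul_of_nonneg_left this (by linarith)
    · calc _ = (1 - 1 / (4 * (N : ℝ) ^ 2)) * (Θ * recordFactor N * T ^ N) := by ring
        _ ≤ _ := by gcongr
  have htsum : ∑' n, u (N + n) ≤ (Z * A N ^ 2 + C) * (2 : ℝ) ^ (A N ^ κ - A N) := by
    have hsplit : ∑' n, u (N + n) = ∑ n ∈ Finset.Ico N L, u n + ∑' n, u (L + n) := by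
      have hsN : Summable fun n => u (N + n) := hus.comp_injective (add_right_injective N)
      rw [← hsN.sum_add_tsum_nat_add (L - N), Finset.sum_Ico_eq_sum_range]
      congr 2
      funext n
      congr 1
      omega
    have h1 := sum_Ico_le_of_le_two_rpow (L := L) hA hx₀ hN1 hxx₀ hlow
      fun n hn => (hN₁ n (hNN₁.trans hn)).2
    have h2 : ∑' n, u (L + n) ≤ C * (2 : ℝ) ^ (A N ^ κ - A N) := by
      refine (hN₁ L (hNN₁.trans hNL)).1.trans ?_
      have : 0 ≤ A N ^ κ := by positivity
      gcongr
      · exact one_le_two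
      · linarith
    rw [hsplit]
    calc _ ≤ Z * (A N ^ 2 * (2 : ℝ) ^ (A N ^ κ - A N)) + C * (2 : ℝ) ^ (A N ^ κ - A N) :=
          add_le_add h1 h2
      _ = _ := by ring
  refine lt_of_le_of_lt ?_ hq
  calc _ ≤ (2 : ℝ) ^ ((N : ℝ) ^ 2 * A N ^ c + (T - 1) * ∑ n ∈ Finset.range N, A n)
        * ((Z * A N ^ 2 + C) * (2 : ℝ) ^ (A N ^ κ - A N)) := by gcongr
    _ = (Z * A N ^ 2 + C) * (2 : ℝ) ^ ((N : ℝ) ^ 2 * A N ^ c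
        + (T - 1) * ∑ n ∈ Finset.range N, A n + (A N ^ κ - A N)) := by
        rw [Real.rpow_add two_pos _ (A N ^ κ - A N)]; ring
    _ ≤ _ := by
        gcongr
        · norm_num
        · have h1 : (T - 1) * (N : ℝ) ^ 2 ≤ (T - 1) * A N ^ (s + σ) :=
            mul_le_mul_of_nonneg_left (hsq'.trans hσp) (by linarith)
          have h2 : 1 / (4 * (N : ℝ) ^ 2) * A N = 1 / 4 * (1 / (N : ℝ) ^ 2 * A N) := by
            field_simp
          linarith

theorem exists_jump_or_record {A : ℕ → ℝ} (hA : Monotone A)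
    {T K δ θ : ℝ} (hT : 2 ≤ T) (hδ : 0 < δ) (hK0 : 0 < K)
    (hθ0 : 0 < θ) (hθ2 : θ ≤ 1 / 2) (hθK : 3 * K * θ ≤ δ)
    (hAtop : Tendsto A atTop atTop)
    (hsup : ∀ C : ℝ, ∃ᶠ n : ℕ in atTop, C * T ^ n < A n) (N₀ : ℕ) :
    ∃ N, N₀ ≤ N ∧ ((θ * T ^ N ≤ A N ∧ K * ∑ n ∈ Finset.range N, A n ≤ A N) ∨
      ∃ (m L : ℕ) (Θ : ℝ), m ≤ N ∧ N ≤ L ∧ θ ≤ Θ ∧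
        (∑ n ∈ Finset.range m, A n ≤ (m : ℝ) ^ 2) ∧
        (∀ n, m ≤ n → n < N → A n < Θ * recordFactor n * T ^ n) ∧
        Θ * recordFactor N * T ^ N ≤ A N ∧
        (∀ n, N ≤ n → n < L → (n : ℝ) ≤ A n) ∧ A N ≤ δ * A L) := by
  have hsq1 := eventually_sq_le_rpow hT hθ0 one_pos
  obtain ⟨N₁, hN₁⟩ := eventually_atTop.mp hsq1
  have hT1 : ∀ n : ℕ, 1 ≤ T ^ n := fun n => one_le_pow₀ (by linarith)
  by_cases hlarge : ∀ᶠ n : ℕ in atTop, (n : ℝ) ≤ A n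
  · obtain ⟨N₂, hN₂⟩ := eventually_atTop.mp hlarge
    set R : ℕ := max N₀ (max N₁ N₂) with hR
    set Θ : ℝ := max θ (A R + 1) with hΘ
    have hΘ1 : 0 < Θ := lt_max_of_lt_left hθ0
    have hex : ∃ n, Θ * recordFactor n * T ^ n ≤ A n := by
      obtain ⟨n, hn⟩ := (hsup (Θ * 2)).exists
      refine ⟨n, le_trans ?_ hn.le⟩
      gcongr
      exact recordFactor_le_two n
    classical
    set N := Nat.find hex with hN
    have hNspec := Nat.find_spec hex
    have hNmin : ∀ n, n < N → A n < Θ * recordFactor n * T ^ n :=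
      fun n hn => not_le.mp (Nat.find_min hex hn)
    have hRN : R < N := by
      by_contra! h
      have h1 : A N ≤ A R := hA h
      have h2 : A R + 1 ≤ Θ := le_max_right _ _
      have h3 : Θ * 1 * 1 ≤ Θ * recordFactor N * T ^ N := by
        gcongr
        · have := one_le_recordFactor N
          positivity
        · exact one_le_recordFactor N
        · exact hT1 N
      have h4 : Θ * recordFactor N * T ^ N ≤ A N := hNspec
      linarith
    obtain ⟨L, hL1, hL2⟩ := ((hAtop.eventually_ge_atTop (A N / δ)).and
      (eventually_ge_atTop N)).exists
    refine ⟨N, by omega, Or.inr ⟨0, L, Θ, Nat.zero_le _, hL2, le_max_left _ _,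
      by simp, fun n _ hn => hNmin n hn, hNspec, fun n hn _ => hN₂ n (by omega), ?_⟩⟩
    rwa [div_le_iff₀' hδ] at hL1
  · obtain ⟨m₀, hm₀, hbad₀⟩ := frequently_atTop.mp (not_eventually.mp hlarge) (max N₀ N₁)
    obtain ⟨L, hm₀L, hL⟩ := frequently_atTop.mp (hsup 1) m₀
    rw [one_mul] at hL
    classical
    set q := Nat.findGreatest (fun n => ¬ (n : ℝ) ≤ A n) L with hq
    have hbad : ¬ (q : ℝ) ≤ A q :=
      Nat.findGreatest_spec (P := fun n => ¬ (n : ℝ) ≤ A n) hm₀L hbad₀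
    have hqL' : q ≤ L := Nat.findGreatest_le L
    have hm₀q : m₀ ≤ q := Nat.le_findGreatest hm₀L hbad₀
    have hgood : ∀ n, q < n → n ≤ L → (n : ℝ) ≤ A n := fun n hn hnL =>
      not_not.mp (Nat.findGreatest_is_greatest hn hnL)
    have hqL : q < L := by
      refine lt_of_le_of_ne hqL' fun h => hbad ?_
      have h1 : (L : ℝ) ≤ 2 ^ L := by exact_mod_cast Nat.lt_two_pow_self.le
      have h2 : (2 : ℝ) ^ L ≤ T ^ L := by gcongr
      rw [h]
      linarith
    have hex : ∃ n, q + 1 ≤ n ∧ θ * recordFactor n * T ^ n ≤ A n := by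
      refine ⟨L, hqL, le_trans ?_ hL.le⟩
      refine mul_le_of_le_one_left (by positivity) ?_
      nlinarith [recordFactor_le_two L, one_le_recordFactor L]
    set N := Nat.find hex with hN
    obtain ⟨hqN, hNspec⟩ := Nat.find_spec hex
    have hqN' : q + 1 ≤ N := hqN
    have hNspec' : θ * recordFactor N * T ^ N ≤ A N := hNspec
    have hNmin : ∀ n, q + 1 ≤ n → n < N → A n < θ * recordFactor n * T ^ n :=
      fun n hqn hn => not_le.mp fun h => Nat.find_min hex hn ⟨hqn, h⟩
    have hNL : N ≤ L := by
      by_contra! h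
      have h1 := hNmin L hqL h
      have h2 : θ * recordFactor L * T ^ L ≤ T ^ L := by
        refine mul_le_of_le_one_left (by positivity) ?_
        nlinarith [recordFactor_le_two L, one_le_recordFactor L]
      linarith
    have hsqN := hN₁ N (by omega)
    rw [Real.rpow_one] at hsqN
    have hTN : 0 < T ^ N := by positivity
    have hθA : θ * T ^ N ≤ A N := by
      refine le_trans ?_ hNspec'
      gcongr
      nlinarith [one_le_recordFactor N]
    have hSq : ∑ n ∈ Finset.range (q + 1), A n ≤ ((q + 1 : ℕ) : ℝ) ^ 2 := by
      calc ∑ n ∈ Finset.range (q + 1), A n ≤ ∑ n ∈ Finset.range (q + 1), ((q + 1 : ℕ) : ℝ) := by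
            refine Finset.sum_le_sum fun n hn => ?_
            have h1 : A n ≤ A q := hA (by have := Finset.mem_range.mp hn; omega)
            push_cast
            linarith
        _ = _ := by rw [Finset.sum_const, Finset.card_range, nsmul_eq_mul, sq]
    refine ⟨N, by omega, ?_⟩
    by_cases hK' : K * ∑ n ∈ Finset.range N, A n ≤ A N
    · exact Or.inl ⟨hθA, hK'⟩
    · refine Or.inr ⟨q + 1, L, θ, hqN', hNL, le_rfl, hSq, hNmin, hNspec',
        fun n hn hnL => hgood n (by omega) hnL.le, ?_⟩
      have hS : ∑ n ∈ Finset.range N, A n ≤ 3 * θ * T ^ N := by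
        have h1 := mul_sum_range_le_of_le_mul_pow (A := A) (T := T) (B := θ * 2) (by linarith)
          (by positivity) hqN' (fun n hn hnN => (hNmin n hn hnN).le.trans (by
            gcongr
            exact recordFactor_le_two n))
        have h2 : ((q + 1 : ℕ) : ℝ) ^ 2 ≤ (N : ℝ) ^ 2 := by
          have : ((q + 1 : ℕ) : ℝ) ≤ N := by exact_mod_cast hqN'
          gcongr
        have h3 : (T - 1) * ∑ n ∈ Finset.range (q + 1), A n ≤ (T - 1) * (θ * T ^ N) :=
          mul_le_mul_of_nonneg_left (by linarith) (by linarith)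
        have h4 : 0 < θ * T ^ N := by positivity
        have h5 : (T - 1) * ∑ n ∈ Finset.range N, A n ≤ (T - 1) * (3 * θ * T ^ N) := by
          nlinarith
        exact le_of_mul_le_mul_left h5 (by linarith)
      calc A N ≤ K * ∑ n ∈ Finset.range N, A n := (not_le.mp hK').le
        _ ≤ K * (3 * θ * T ^ N) := by gcongr
        _ = 3 * K * θ * T ^ N := by ring
        _ ≤ δ * T ^ L := by
            gcongr
            linarith
        _ ≤ δ * A L := by gcongr

theorem frequently_two_rpow_mul_tsum_lt {A u : ℕ → ℝ} (hA : Monotone A)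
    (hu : ∀ n, 0 ≤ u n) {ε κ c T : ℝ} (hε : 0 < ε) (hκ0 : 0 < κ) (hκ1 : κ < 1) (hc1 : c < 1)
    (hT : 2 ≤ T)
    (hgrow : ∀ᶠ n : ℕ in atTop, (n : ℝ) ^ (1 + ε) ≤ (2 : ℝ) ^ A n)
    (hAtop : Tendsto A atTop atTop)
    (hbd : ∀ᶠ n in atTop, u n ≤ (2 : ℝ) ^ (A n ^ κ - A n))
    (hsup : ∀ C : ℝ, ∃ᶠ n : ℕ in atTop, C * T ^ n < A n) {δ₀ : ℝ} (hδ₀ : 0 < δ₀) :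
    ∃ᶠ N : ℕ in atTop,
      (2 : ℝ) ^ ((N : ℝ) ^ 2 * A N ^ c + (T - 1) * ∑ n ∈ Finset.range N, A n)
        * ∑' n, u (N + n) < δ₀ := by
  obtain ⟨hus, C, δ, hC, hδ, htail⟩ := exists_tsum_tail_le hA hu hε hκ1 hgrow hAtop hbd
  have hK0 : 0 < 2 * (T - 1) / δ := div_pos (by linarith) hδ
  obtain ⟨θ, hθ0, hθ2, hθK⟩ : ∃ θ : ℝ, 0 < θ ∧ θ ≤ 1 / 2 ∧ 3 * (2 * (T - 1) / δ) * θ ≤ δ := by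
    refine ⟨min (1 / 2) (δ / (3 * (2 * (T - 1) / δ))), lt_min (by norm_num) (by positivity),
      min_le_left _ _, ?_⟩
    rw [← le_div_iff₀' (by positivity)]
    exact min_le_right _ _
  obtain ⟨N₁, hN₁⟩ := eventually_atTop.mp
    ((eventually_two_rpow_mul_tsum_lt_of_jump hu hc1 hT hδ hθ0 hAtop htail hδ₀).and
      (eventually_two_rpow_mul_tsum_lt_of_record hA hus hκ0 hκ1 hc1 hT hC hθ0 hAtop hbd htail hδ₀))
  rw [frequently_atTop]
  intro N₀
  obtain ⟨N, hN, h | ⟨m, L, Θ, h1, h2, h3, h4, h5, h6, h7, h8⟩⟩ :=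
    exists_jump_or_record hA hT hδ hK0 hθ0 hθ2 hθK hAtop hsup (max N₀ N₁)
  · exact ⟨N, (le_max_left _ _).trans hN, (hN₁ N ((le_max_right _ _).trans hN)).1 h.1 h.2⟩
  · exact ⟨N, (le_max_left _ _).trans hN,
      (hN₁ N ((le_max_right _ _).trans hN)).2 m L Θ h1 h2 h3 h4 h5 h6 h7 h8⟩

theorem stmt7 (a b : ℕ → ℕ) (hapos : ∀ n, 0 < a n) (hbpos : ∀ n, 0 < b n)
    (hmono : Monotone a)
    (ε : ℝ) (hε : 0 < ε) (hgrow : ∀ᶠ n : ℕ in atTop, (n : ℝ) ^ (1 + ε) ≤ (a n : ℝ))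
    (M : ℝ) (hM : 0 ≤ M)
    (hlimsup : ∀ C : ℝ, ∃ᶠ n : ℕ in atTop, C < (a n : ℝ) ^ (((M + 2) ^ n)⁻¹))
    (κ : ℝ) (hκ0 : 0 < κ) (hκ1 : κ < 1)
    (hbbd : ∀ᶠ n : ℕ in atTop, (b n : ℝ) ≤ 2 ^ (Real.logb 2 (a n) ^ κ))
    (c : ℝ) (hc0 : 0 < c) (hc1 : c < 1) :
    Filter.liminf (fun N : ℕ =>
        (2 : ℝ) ^ ((N : ℝ) ^ 2 * Real.logb 2 (a (N - 1)) ^ c)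
          * (∏ n ∈ Finset.Ico 1 N, (a n : ℝ)) ^ (M + 1)
          * ∑' n : ℕ, (b (N + n) : ℝ) / (a (N + n) : ℝ)) atTop = 0 := by
  have ha1 : ∀ n, (1 : ℝ) ≤ a n := fun n => by exact_mod_cast hapos n
  have ha0 : ∀ n, (0 : ℝ) < a n := fun n => by exact_mod_cast hapos n
  set A : ℕ → ℝ := fun n => Real.logb 2 (a n) with hAdef
  have hpow : ∀ n, (2 : ℝ) ^ A n = a n := fun n =>
    Real.rpow_logb two_pos (by norm_num) (ha0 n)
  have hA0 : ∀ n, 0 ≤ A n := fun n => Real.logb_nonneg one_lt_two (ha1 n)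
  have hA : Monotone A := fun m n hmn =>
    Real.logb_le_logb_of_le one_lt_two (ha0 m) (by exact_mod_cast hmono hmn)
  have haTop : Tendsto (fun n => (a n : ℝ)) atTop atTop :=
    tendsto_atTop_mono' _ hgrow
      ((tendsto_rpow_atTop (by linarith : 0 < 1 + ε)).comp tendsto_natCast_atTop_atTop)
  have hAtop : Tendsto A atTop atTop := (Real.tendsto_logb_atTop one_lt_two).comp haTop
  have hsup : ∀ C : ℝ, ∃ᶠ n : ℕ in atTop, C * (M + 2) ^ n < A n := by
    intro C
    refine (hlimsup ((2 : ℝ) ^ C)).mono fun n hn => ?_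
    have hT : 0 < (M + 2) ^ n := by positivity
    rw [← hpow n, ← Real.rpow_mul two_pos.le, Real.rpow_lt_rpow_left_iff one_lt_two,
      ← div_eq_mul_inv, lt_div_iff₀ hT] at hn
    exact hn
  have hfreq : ∀ δ₀ : ℝ, 0 < δ₀ → ∃ᶠ N : ℕ in atTop,
      (2 : ℝ) ^ ((N : ℝ) ^ 2 * Real.logb 2 (a (N - 1)) ^ c)
          * (∏ n ∈ Finset.Ico 1 N, (a n : ℝ)) ^ (M + 1)
          * ∑' n : ℕ, (b (N + n) : ℝ) / (a (N + n) : ℝ) < δ₀ := by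
    intro δ₀ hδ₀
    have h := frequently_two_rpow_mul_tsum_lt (u := fun n => (b n : ℝ) / a n) (c := c)
      hA (fun n => by positivity)
      hε hκ0 hκ1 hc1 (by linarith : 2 ≤ M + 2) (by simpa only [hpow] using hgrow) hAtop
      (by
        filter_upwards [hbbd] with n hn
        rw [Real.rpow_sub two_pos, hpow]
        gcongr) hsup hδ₀
    refine h.mono fun N hN => lt_of_le_of_lt ?_ hN
    have hprod : (∏ n ∈ Finset.Ico 1 N, (a n : ℝ)) ≤ (2 : ℝ) ^ ∑ n ∈ Finset.range N, A n := by
      calc ∏ n ∈ Finset.Ico 1 N, (a n : ℝ) = (2 : ℝ) ^ ∑ n ∈ Finset.Ico 1 N, A n := by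
            rw [Real.rpow_sum_of_pos two_pos]
            simp only [hpow]
        _ ≤ _ := by
            refine Real.rpow_le_rpow_of_exponent_le one_le_two
              (Finset.sum_le_sum_of_subset_of_nonneg (fun n hn => ?_) fun n _ _ => hA0 n)
            exact Finset.mem_range.mpr (Finset.mem_Ico.mp hn).2
    rw [Real.rpow_add two_pos]
    refine mul_le_mul_of_nonneg_right (mul_le_mul ?_ ?_ (by positivity) (by positivity))
      (tsum_nonneg fun n => by positivity)
    · have h1 : A (N - 1) ≤ A N := hA (Nat.sub_le N 1)
      have h2 : A (N - 1) ^ c ≤ A N ^ c := Real.rpow_le_rpow (hA0 _) h1 hc0.le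
      apply Real.rpow_le_rpow_of_exponent_le one_le_two
      gcongr
    · calc (∏ n ∈ Finset.Ico 1 N, (a n : ℝ)) ^ (M + 1)
          ≤ ((2 : ℝ) ^ ∑ n ∈ Finset.range N, A n) ^ (M + 1) := by gcongr
        _ = _ := by rw [← Real.rpow_mul two_pos.le]; ring_nf
  have hnonneg : ∀ N : ℕ, 0 ≤ (2 : ℝ) ^ ((N : ℝ) ^ 2 * Real.logb 2 (a (N - 1)) ^ c)
      * (∏ n ∈ Finset.Ico 1 N, (a n : ℝ)) ^ (M + 1)
      * ∑' n : ℕ, (b (N + n) : ℝ) / (a (N + n) : ℝ) := fun N =>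
    mul_nonneg (by positivity) (tsum_nonneg fun n => by positivity)
  apply le_antisymm
  · refine le_of_forall_pos_le_add fun δ₀ hδ₀ => ?_
    rw [zero_add]
    exact Filter.liminf_le_of_frequently_le ((hfreq δ₀ hδ₀).mono fun _ h => h.le)
      ⟨0, eventually_map.mpr (Eventually.of_forall hnonneg)⟩
  · refine Filter.le_liminf_of_le ?_ (Eventually.of_forall hnonneg)
    exact IsCoboundedUnder.of_frequently_le ((hfreq 1 one_pos).mono fun _ h => h.le)
end

section
/- Let z ≥ 2 be an integer and let {a_n} be a non-decreasing sequence of positive integers coprime with z such that limsup_{n→∞} a_n^{1/A^n} = ∞ for every positive integer A. Let {r_n} be a sequence of pairwise distinct non-negative integers and p a prime dividing z. Then for every sequence of integers {c_n} with p ∤ c_n, the series Σ_{n=1}^∞ 1/(z^{r_n} · a_n · c_n) converges to a transcendental number. -/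
open Filter

/-- Indices can be enumerated greedily, always adding one that minimises `b` among those left. -/
lemma exists_greedy_enumeration (b : ℕ → ℕ) :
    ∃ (S : ℕ → Finset ℕ) (m : ℕ → ℕ), S 0 = ∅ ∧ (∀ k, S (k + 1) = insert (m k) (S k)) ∧
      (∀ k, m k ∉ S k) ∧ ∀ k, ∀ n ∉ S k, b (m k) ≤ b n := by
  have h : ∀ s : Finset ℕ, ∃ g, g ∉ s ∧ ∀ n ∉ s, b g ≤ b n := by
    intro s
    have hne : ((s : Set ℕ)ᶜ).Nonempty := s.finite_toSet.infinite_compl.nonempty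
    refine ⟨Function.argminOn b _ hne, Function.argminOn_mem b _ hne, fun n hn => ?_⟩
    exact Function.argminOn_le b _ (by simpa using hn)
  choose g hg hmin using h
  let S : ℕ → Finset ℕ := fun k => Nat.rec ∅ (fun _ s => insert (g s) s) k
  exact ⟨S, fun k => g (S k), rfl, fun k => rfl, fun k => hg _, fun k => hmin _⟩

/-- A finite set with more than `k` elements, mapped injectively to `ℕ`, takes a value `≥ k`. -/
lemma Finset.exists_le_of_lt_card {f : ℕ → ℕ} (hf : Function.Injective f) {s : Finset ℕ} {k : ℕ}
    (hs : k < s.card) : ∃ n ∈ s, k ≤ f n := by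
  by_contra! h
  have h1 : s.image f ⊆ Finset.range k := by
    intro x hx
    obtain ⟨n, hn, rfl⟩ := Finset.mem_image.1 hx
    exact Finset.mem_range.2 (h n hn)
  have h2 := Finset.card_le_card h1
  rw [Finset.card_image_of_injective _ hf, Finset.card_range] at h2
  omega

/-- If `B` dominates a sequence of super-iterated-exponential growth, then infinitely often `B k`
exceeds any given power of the product of its predecessors. -/
lemma frequently_pow_lt {Q B a : ℕ → ℕ} (hQpos : ∀ k, 1 ≤ Q k)
    (hQ : ∀ k, Q (k + 1) = Q k * B k) (hab : ∀ k, a (k + 1) ≤ B k)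
    (hlimsup : ∀ A : ℕ, 0 < A → ∀ C : ℝ,
      ∃ᶠ n : ℕ in atTop, C < (a n : ℝ) ^ (((A : ℝ) ^ n)⁻¹)) (M : ℕ) :
    ∃ᶠ k in atTop, Q k ^ M < B k := by
  by_contra hcon
  simp only [not_frequently, not_lt, eventually_atTop] at hcon
  obtain ⟨k₀, hk₀⟩ := hcon
  have key : ∀ j, Q (k₀ + j) ≤ Q k₀ ^ ((M + 1) ^ j) := by
    intro j
    induction j with
    | zero => simp
    | succ j ih =>
      calc Q (k₀ + (j + 1)) = Q (k₀ + j) * B (k₀ + j) := hQ _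
        _ ≤ Q (k₀ + j) * Q (k₀ + j) ^ M := Nat.mul_le_mul_left _ (hk₀ _ (by omega))
        _ = Q (k₀ + j) ^ (M + 1) := by ring
        _ ≤ (Q k₀ ^ ((M + 1) ^ j)) ^ (M + 1) := Nat.pow_le_pow_left ih _
        _ = Q k₀ ^ ((M + 1) ^ (j + 1)) := by rw [← pow_mul, pow_succ]
  obtain ⟨n, hn, hlt⟩ :=
    (frequently_atTop.1 (hlimsup (M + 1) (Nat.succ_pos M) (Q k₀))) (k₀ + 1)
  obtain ⟨j, rfl⟩ := Nat.exists_eq_add_of_le hn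
  have h1 : a (k₀ + 1 + j) ≤ Q k₀ ^ ((M + 1) ^ (k₀ + 1 + j)) :=
    calc a (k₀ + 1 + j) = a (k₀ + j + 1) := by congr 1; ring
      _ ≤ B (k₀ + j) := hab _
      _ ≤ Q (k₀ + j) * B (k₀ + j) := Nat.le_mul_of_pos_left _ (hQpos _)
      _ = Q (k₀ + (j + 1)) := (hQ _).symm
      _ ≤ Q k₀ ^ ((M + 1) ^ (j + 1)) := key _
      _ ≤ Q k₀ ^ ((M + 1) ^ (k₀ + 1 + j)) :=
        Nat.pow_le_pow_right (hQpos _) (Nat.pow_le_pow_right (Nat.succ_pos M) (by omega))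
  refine absurd hlt (not_lt.2 ?_)
  calc ((a (k₀ + 1 + j) : ℕ) : ℝ) ^ ((((M + 1 : ℕ) : ℝ) ^ (k₀ + 1 + j))⁻¹)
      ≤ ((Q k₀ : ℝ) ^ ((M + 1) ^ (k₀ + 1 + j))) ^ ((((M + 1 : ℕ) : ℝ) ^ (k₀ + 1 + j))⁻¹) := by
        refine Real.rpow_le_rpow (by positivity) (by exact_mod_cast h1) (by positivity)
    _ = Q k₀ := by
        rw [← Nat.cast_pow (M + 1) (k₀ + 1 + j)]
        exact Real.pow_rpow_inv_natCast (by positivity) (by positivity)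

/-- A nonempty finite sum of rationals with pairwise distinct `p`-adic norms is nonzero. -/
lemma sum_ne_zero_of_injective_padicNorm {p : ℕ} [Fact p.Prime] {t : ℕ → ℚ}
    (ht : Function.Injective fun n => padicNorm p (t n)) (ht0 : ∀ n, t n ≠ 0)
    {T : Finset ℕ} (hT : T.Nonempty) : ∑ n ∈ T, t n ≠ 0 := by
  obtain ⟨m, hm, hmax⟩ := T.exists_max_image (fun n => padicNorm p (t n)) hT
  intro h0
  rw [← Finset.add_sum_erase _ _ hm] at h0
  have hpos : 0 < padicNorm p (t m) :=
    lt_of_le_of_ne (padicNorm.nonneg _) (padicNorm.nonzero (ht0 m)).symm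
  have hlt : padicNorm p (∑ n ∈ T.erase m, t n) < padicNorm p (t m) := by
    refine padicNorm.sum_lt' (fun n hn => ?_) hpos
    exact lt_of_le_of_ne (hmax n (Finset.mem_of_mem_erase hn))
      fun h => Finset.ne_of_mem_erase hn (ht h)
  rw [← padicNorm.neg, ← eq_neg_of_add_eq_zero_left h0] at hlt
  exact lt_irrefl _ hlt

lemma padicNorm_one_div_mul {p z : ℕ} [Fact p.Prime] {a : ℕ} {c : ℤ} (r : ℕ)
    (ha : ¬ p ∣ a) (hc : ¬ (p : ℤ) ∣ c) :
    padicNorm p (1 / ((z : ℚ) ^ r * a * c)) = ((padicNorm p z)⁻¹) ^ r := by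
  have h1 : padicNorm p (a : ℚ) = 1 := (padicNorm.nat_eq_one_iff a).2 ha
  have h2 : padicNorm p (c : ℚ) = 1 := (padicNorm.int_eq_one_iff c).2 hc
  have h3 : padicNorm p ((z : ℚ) ^ r) = padicNorm p z ^ r := by
    induction r with
    | zero => simp
    | succ r ih => rw [pow_succ, padicNorm.mul, ih, pow_succ]
  rw [padicNorm.div, padicNorm.mul, padicNorm.mul, h1, h2, h3]
  simp

/-- A bound for a series all of whose terms are at most `1 / B` and at most `1 / z ^ r n`. -/
lemma abs_tsum_le_of_le {t : ℕ → ℝ} {z : ℕ} (hz : 2 ≤ z) {r : ℕ → ℕ} (hr : Function.Injective r)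
    {B : ℝ} (hB : 0 < B) (h1 : ∀ n, |t n| ≤ 1 / B) (h2 : ∀ n, |t n| ≤ 1 / (z : ℝ) ^ r n) :
    |∑' n, t n| ≤ (√B)⁻¹ * ∑' j : ℕ, ((√2)⁻¹) ^ j := by
  have hs : Summable fun j : ℕ => ((√2)⁻¹ : ℝ) ^ j := by
    refine summable_geometric_of_lt_one (by positivity) (inv_lt_one_of_one_lt₀ ?_)
    exact Real.lt_sqrt_of_sq_lt (by norm_num)
  have hle : ∀ n, ‖t n‖ ≤ (√B)⁻¹ * ((√2)⁻¹) ^ r n := by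
    intro n
    rw [Real.norm_eq_abs]
    refine abs_le_of_sq_le_sq' ?_ (by positivity) |>.2
    have e : ((√B)⁻¹ * ((√2)⁻¹) ^ r n) ^ 2 = 1 / B * (1 / (2 : ℝ) ^ r n) := by
      rw [mul_pow, inv_pow, Real.sq_sqrt hB.le, ← pow_mul, mul_comm (r n), pow_mul, inv_pow,
        Real.sq_sqrt (by norm_num)]
      simp
    rw [e, sq]
    have hz' : (2 : ℝ) ≤ z := by exact_mod_cast hz
    refine mul_le_mul (h1 n) ((h2 n).trans ?_) (abs_nonneg _) (by positivity)
    exact one_div_le_one_div_of_le (by positivity) (pow_le_pow_left₀ (by norm_num) hz' _)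
  have hsr := (hs.comp_injective hr).mul_left (√B)⁻¹
  calc |∑' n, t n| ≤ ∑' n, (√B)⁻¹ * ((√2)⁻¹) ^ r n := tsum_of_norm_bounded hsr.hasSum hle
    _ = (√B)⁻¹ * ∑' n, ((√2)⁻¹) ^ r n := tsum_mul_left
    _ ≤ _ := by
      refine mul_le_mul_of_nonneg_left ?_ (by positivity)
      exact (hs.comp_injective hr).tsum_le_tsum_of_inj r hr (fun _ _ => by positivity)
        (fun _ => le_rfl) hs

lemma exists_int_sum_eq_div {t : ℕ → ℚ} {b : ℕ → ℕ} (ht : ∀ n, ∃ u : ℤ, t n = u / b n)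
    (hb : ∀ n, 0 < b n) (S : Finset ℕ) :
    ∃ u : ℤ, ∑ n ∈ S, t n = u / ((2 * ∏ n ∈ S, b n : ℕ) : ℚ) := by
  classical
  induction S using Finset.induction_on with
  | empty => exact ⟨0, by simp⟩
  | insert m S hm ih =>
    obtain ⟨u, hu⟩ := ih
    obtain ⟨v, hv⟩ := ht m
    have h1 : (b m : ℚ) ≠ 0 := by exact_mod_cast (hb m).ne'
    have h2 : (∏ n ∈ S, (b n : ℚ)) ≠ 0 :=
      Finset.prod_ne_zero_iff.2 fun n _ => by exact_mod_cast (hb n).ne'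
    refine ⟨v * (2 * ∏ n ∈ S, (b n : ℤ)) + u * b m, ?_⟩
    rw [Finset.sum_insert hm, Finset.prod_insert hm, hu, hv]
    push_cast
    field_simp

theorem stmt17 (z : ℕ) (hz : 2 ≤ z)
    (a : ℕ → ℕ) (hmono : Monotone a) (hpos : ∀ n, 1 ≤ n → 0 < a n)
    (hcop : ∀ n, 1 ≤ n → Nat.Coprime (a n) z)
    (hlimsup : ∀ A : ℕ, 0 < A → ∀ C : ℝ,
      ∃ᶠ n : ℕ in atTop, C < (a n : ℝ) ^ (((A : ℝ) ^ n)⁻¹))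
    (r : ℕ → ℕ) (hr : Function.Injective r)
    (p : ℕ) (hp : p.Prime) (hpz : p ∣ z)
    (c : ℕ → ℤ) (hc : ∀ n, ¬ ((p : ℤ) ∣ c n)) :
    Transcendental ℤ (∑' n : ℕ,
      1 / ((z : ℝ) ^ r (n + 1) * (a (n + 1) : ℝ) * (c (n + 1) : ℝ))) := by
  have : Fact p.Prime := ⟨hp⟩
  have hr' : Function.Injective fun n => r (n + 1) := hr.comp (add_left_injective 1)
  have hc0 : ∀ n, 0 < (c n).natAbs := fun n =>
    Int.natAbs_pos.2 fun h => hc n (h ▸ dvd_zero _)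
  have hz0 : 0 < z := by omega
  set b : ℕ → ℕ := fun n => z ^ r (n + 1) * a (n + 1) * (c (n + 1)).natAbs with hb
  set t : ℕ → ℚ := fun n => 1 / ((z : ℚ) ^ r (n + 1) * a (n + 1) * c (n + 1)) with ht
  have hbpos : ∀ n, 0 < b n := fun n =>
    Nat.mul_pos (Nat.mul_pos (pow_pos hz0 _) (hpos _ (by omega))) (hc0 _)
  have hba : ∀ n, a (n + 1) ≤ b n := fun n =>
    (Nat.le_mul_of_pos_left _ (pow_pos hz0 _)).trans (Nat.le_mul_of_pos_right _ (hc0 _))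
  have hbz : ∀ n, z ^ r (n + 1) ≤ b n := fun n =>
    (Nat.le_mul_of_pos_right _ (hpos _ (by omega))).trans (Nat.le_mul_of_pos_right _ (hc0 _))
  have habs : ∀ n, |(t n : ℝ)| = 1 / b n := by
    intro n
    simp only [ht, hb]
    push_cast
    rw [abs_div, abs_mul, abs_mul, abs_one, abs_pow, Nat.abs_cast, Nat.abs_cast,
      Nat.cast_natAbs, Int.cast_abs]
  have htu : ∀ n, ∃ u : ℤ, t n = u / b n := by
    intro n
    have e : |t n| = 1 / b n := by
      refine Rat.cast_injective (α := ℝ) ?_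
      push_cast
      exact habs n
    rcases (abs_eq (by positivity)).1 e with h | h
    · exact ⟨1, by simpa using h⟩
    · exact ⟨-1, by rw [h]; push_cast; ring⟩
  have hnz : ∀ T : Finset ℕ, T.Nonempty → ∑ n ∈ T, t n ≠ 0 := by
    intro T hT
    have hnorm : ∀ n, padicNorm p (t n) = ((padicNorm p z)⁻¹) ^ r (n + 1) := fun n =>
      padicNorm_one_div_mul _
        (fun h => Nat.not_coprime_of_dvd_of_dvd hp.one_lt h hpz (hcop _ (Nat.le_add_left 1 n))) (hc _)
    refine sum_ne_zero_of_injective_padicNorm (p := p) ?_ ?_ hT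
    · simp only [hnorm]
      have hz1 : padicNorm p z < 1 := (padicNorm.nat_lt_one_iff z).2 hpz
      have hz2 : 0 < padicNorm p z := lt_of_le_of_ne (padicNorm.nonneg _)
        (padicNorm.nonzero (by exact_mod_cast hz0.ne')).symm
      exact (pow_right_injective₀ (inv_pos.2 hz2) ((one_lt_inv₀ hz2).2 hz1).ne').comp hr'
    · intro n h
      have h1 := habs n
      have h2 : (0 : ℝ) < 1 / b n := one_div_pos.2 (by exact_mod_cast hbpos n)
      rw [← h1, h, Rat.cast_zero, abs_zero] at h2
      exact lt_irrefl _ h2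
  obtain ⟨S, m, hS0, hS, hmS, hmin⟩ := exists_greedy_enumeration b
  have hSmono : Monotone S := monotone_nat_of_le_succ fun k => by
    rw [hS]; exact Finset.subset_insert _ _
  have hcard : ∀ k, (S k).card = k := by
    intro k
    induction k with
    | zero => simp [hS0]
    | succ k ih => rw [hS, Finset.card_insert_of_notMem (hmS k), ih]
  have hle : ∀ k, ∀ n ∈ S (k + 1), b n ≤ b (m k) := by
    intro k
    induction k with
    | zero => intro n hn; simp_all
    | succ k ih =>
      intro n hn
      rw [hS, Finset.mem_insert] at hn
      rcases hn with rfl | hn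
      · exact le_rfl
      · refine (ih n hn).trans (hmin k _ fun h => hmS (k + 1) (hSmono k.le_succ h))
  have haB : ∀ k, a (k + 1) ≤ b (m k) := by
    intro k
    obtain ⟨n, hn, hkn⟩ := Finset.exists_le_of_lt_card Function.injective_id
      (s := S (k + 1)) (k := k) (by rw [hcard]; omega)
    exact (hmono (Nat.succ_le_succ hkn)).trans ((hba n).trans (hle k n hn))
  set Q : ℕ → ℕ := fun k => 2 * ∏ n ∈ S k, b n with hQ
  have hQ2 : ∀ k, 2 ≤ Q k := fun k =>
    Nat.le_mul_of_pos_right _ (Finset.prod_pos fun n _ => hbpos n)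
  have hQs : ∀ k, Q (k + 1) = Q k * b (m k) := by
    intro k
    simp only [hQ, hS, Finset.prod_insert (hmS k)]
    ring
  have hfreq := frequently_pow_lt (fun k => (by omega : 1 ≤ 2).trans (hQ2 k)) hQs haB hlimsup
  set K : ℝ := ∑' j : ℕ, ((√2)⁻¹ : ℝ) ^ j with hK
  have hsum : Summable fun n => (t n : ℝ) := by
    refine Summable.of_norm_bounded (g := fun n => ((1 : ℝ) / 2) ^ r (n + 1))
      (summable_geometric_two.comp_injective hr') fun n => ?_
    rw [Real.norm_eq_abs, habs, div_pow, one_pow]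
    refine one_div_le_one_div_of_le (by positivity) ?_
    exact_mod_cast (Nat.pow_le_pow_left hz _).trans (hbz n)
  have hα : (∑' n : ℕ, 1 / ((z : ℝ) ^ r (n + 1) * (a (n + 1) : ℝ) * (c (n + 1) : ℝ)))
      = ∑' n, (t n : ℝ) := tsum_congr fun n => by simp [ht]
  rw [hα]
  have htail : ∀ k, |∑' n, (t n : ℝ) - ∑ n ∈ S k, (t n : ℝ)| ≤ (√(b (m k)))⁻¹ * K := by
    intro k
    have e : ∑' n, (t n : ℝ) - ∑ n ∈ S k, (t n : ℝ)
        = ∑' n, ((↑(S k) : Set ℕ)ᶜ).indicator (fun n => (t n : ℝ)) n := by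
      rw [← hsum.sum_add_tsum_compl (s := S k), add_sub_cancel_left]
      exact tsum_subtype _ fun n => (t n : ℝ)
    rw [e]
    have hB : (0 : ℝ) < b (m k) := by exact_mod_cast hbpos _
    refine abs_tsum_le_of_le hz hr' hB (fun n => ?_) (fun n => ?_) <;>
    · by_cases hn : n ∈ S k
      · simp [hn]
      · rw [Set.indicator_of_mem (by simpa using hn), habs]
        refine one_div_le_one_div_of_le (by positivity) ?_
        first
        | exact_mod_cast hmin k n hn
        | exact_mod_cast hbz n
  refine Liouville.transcendental fun D => ?_
  obtain ⟨E, hE⟩ := pow_unbounded_of_one_lt K (by norm_num : (1 : ℝ) < 2)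
  have hgood : ∀ k, Q k ^ (2 * (E + D)) < b (m k) →
      |∑' n, (t n : ℝ) - ∑ n ∈ S k, (t n : ℝ)| < 1 / (Q k : ℝ) ^ D := by
    intro k hk
    have hQr : (2 : ℝ) ≤ Q k := by exact_mod_cast hQ2 k
    have hQ0 : (0 : ℝ) < Q k := by linarith
    have hsq : (Q k : ℝ) ^ (E + D) < √(b (m k)) := by
      refine Real.lt_sqrt_of_sq_lt ?_
      rw [← pow_mul, mul_comm]
      exact_mod_cast hk
    have hKE : K < (Q k : ℝ) ^ E := hE.trans_le (pow_le_pow_left₀ (by norm_num) hQr _)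
    have hB : 0 < √(b (m k) : ℝ) := lt_trans (by positivity) hsq
    refine (htail k).trans_lt ?_
    rw [inv_mul_eq_div, div_lt_div_iff₀ hB (by positivity), one_mul]
    calc K * (Q k : ℝ) ^ D < (Q k : ℝ) ^ E * (Q k : ℝ) ^ D := by gcongr
      _ = (Q k : ℝ) ^ (E + D) := (pow_add _ _ _).symm
      _ < _ := hsq
  have hex : ∃ k, Q k ^ (2 * (E + D)) < b (m k) ∧
      ∑' n, (t n : ℝ) ≠ ∑ n ∈ S k, (t n : ℝ) := by
    by_contra! hcon
    obtain ⟨i, -, hi⟩ := frequently_atTop.1 (hfreq (2 * (E + D))) 0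
    obtain ⟨j, hij, hj⟩ := frequently_atTop.1 (hfreq (2 * (E + D))) (i + 1)
    have hsub : S i ⊆ S j := hSmono (by omega)
    have heq : ∑ n ∈ S i, t n = ∑ n ∈ S j, t n := by
      exact_mod_cast (hcon i hi).symm.trans (hcon j hj)
    refine hnz (S j \ S i) ?_ ?_
    · rw [← Finset.card_pos, Finset.card_sdiff_of_subset hsub, hcard, hcard]
      omega
    · have := Finset.sum_sdiff (f := t) hsub
      linarith
  obtain ⟨k, hk, hne⟩ := hex
  obtain ⟨u, hu⟩ := exists_int_sum_eq_div htu hbpos (S k)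
  have hur : ∑ n ∈ S k, (t n : ℝ) = (u : ℝ) / ((Q k : ℤ) : ℝ) := by
    exact_mod_cast congrArg (Rat.cast (K := ℝ)) hu
  refine ⟨u, Q k, by exact_mod_cast hQ2 k, ?_, ?_⟩
  · rw [← hur]; exact hne
  · rw [← hur]; simpa using hgood k hk
end
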